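/- Let z ∈ ℝ with z ≥ 0 and ν ∈ ℂ with Re ν > 0. Then (∫₀^∞ e^(−z·t − t²/2) t^(ν−1) dt)² = Γ(ν) · Σ_{n=0}^∞ (−1)^n · He_n(z)² / (n!·(n+ν)), where the series converges. (This is the series expansion (60)–(61) for D₋ν(z)² = (1/Γ(ν)) Σ_{n≥0} (−1)^n D_n(z)²/(n!(n+ν)), written using D₋ν(z) = (e^(−z²/4)/Γ(ν)) ∫₀^∞ e^(−zt−t²/2) t^(ν−1) dt and D_n(z) = e^(−z²/4)·He_n(z).) -/

import Mathlib

open MeasureTheory Complex Set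

theorem derivative_hermite_succ' (n : ℕ) :
    Polynomial.derivative (Polynomial.hermite (n + 1)) = ((n : Polynomial ℤ) + 1) * Polynomial.hermite n := by
  induction n with
  | zero => simp
  | succ n ih =>
    rw [Polynomial.hermite_succ (n + 1), map_sub, Polynomial.derivative_mul, ih,
      Polynomial.derivative_mul]
    have h2 := Polynomial.hermite_succ n
    have h3 : Polynomial.derivative ((n : Polynomial ℤ) + 1) = 0 := by
      simp
    rw [h3]
    simp only [Polynomial.derivative_X]
    push_cast
    linear_combination (-(n:Polynomial ℤ) - 1) * h2

noncomputable def gw (x : ℝ) : ℂ := ((Real.exp (-x ^ 2 / 2) : ℝ) : ℂ)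

theorem gw_int (z : ℝ) (n : ℕ) :
    Integrable (fun x : ℝ => ((z : ℂ) + I * x) ^ n * gw x) := by
  have h1 := (integrable_exp_neg_mul_sq (b := 1 / 4) (by norm_num)).const_mul
    ((n.factorial : ℝ) * Real.exp (1 + z ^ 2 / 4))
  refine h1.mono' ?_ ?_
  · apply Continuous.aestronglyMeasurable
    unfold gw
    fun_prop
  · refine Filter.Eventually.of_forall fun x => ?_
    have hn : ‖(z : ℂ) + I * x‖ ^ 2 = z ^ 2 + x ^ 2 := by
      rw [← normSq_eq_norm_sq]
      simp [normSq_apply]; ring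
    have h2 : ‖(z : ℂ) + I * x‖ ^ n ≤ n.factorial * Real.exp (‖(z : ℂ) + I * x‖) := by
      have := Real.pow_div_factorial_le_exp (‖(z : ℂ) + I * x‖) (norm_nonneg _) n
      rw [div_le_iff₀ (by positivity)] at this
      linarith
    have h3 : ‖(z : ℂ) + I * x‖ ≤ 1 + (z ^ 2 + x ^ 2) / 4 := by
      nlinarith [sq_nonneg (‖(z : ℂ) + I * x‖ / 2 - 1)]
    rw [norm_mul, norm_pow]
    have h4 : ‖gw x‖ = Real.exp (-x ^ 2 / 2) := by
      unfold gw
      rw [norm_real, Real.norm_of_nonneg (Real.exp_pos _).le]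
    rw [h4]
    calc ‖(z : ℂ) + I * x‖ ^ n * Real.exp (-x ^ 2 / 2)
        ≤ n.factorial * Real.exp (1 + (z ^ 2 + x ^ 2) / 4) * Real.exp (-x ^ 2 / 2) := by
          gcongr
          exact h2.trans (by gcongr)
      _ = _ := by
          rw [mul_assoc, mul_assoc, ← Real.exp_add, ← Real.exp_add]
          congr 2; ring

theorem gw_deriv (x : ℝ) : HasDerivAt gw (-(x : ℂ) * gw x) x := by
  unfold gw
  have h1 : HasDerivAt (fun x : ℝ => Real.exp (-x ^ 2 / 2)) (Real.exp (-x ^ 2 / 2) * (-x)) x := by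
    apply HasDerivAt.exp
    have := ((hasDerivAt_id x).pow 2).neg.div_const 2
    refine HasDerivAt.congr_deriv (f := fun x : ℝ => -x ^ 2 / 2) this ?_
    simp
    ring
  refine h1.ofReal_comp.congr_deriv ?_
  push_cast; ring

theorem gw_stein (z : ℝ) (n : ℕ) :
    ∫ x : ℝ, ((z : ℂ) + I * x) ^ (n + 2) * gw x =
      z * (∫ x : ℝ, ((z : ℂ) + I * x) ^ (n + 1) * gw x) -
        ((n : ℂ) + 1) * ∫ x : ℝ, ((z : ℂ) + I * x) ^ n * gw x := by
  have hd : ∀ x : ℝ, HasDerivAt (fun x : ℝ => ((z : ℂ) + I * x) ^ (n + 1) * gw x)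
      (((n : ℂ) + 1) * I * (((z : ℂ) + I * x) ^ n * gw x)
        + (I * (((z : ℂ) + I * x) ^ (n + 2) * gw x) - I * z * (((z : ℂ) + I * x) ^ (n + 1) * gw x))) x := by
    intro x
    have h0 : HasDerivAt (fun x : ℝ => (z : ℂ) + I * x) I x := by
      have := ((hasDerivAt_id x).ofReal_comp.const_mul I).const_add (z : ℂ)
      simpa using this
    have := (h0.pow (n + 1)).mul (gw_deriv x)
    refine HasDerivAt.congr_deriv (f := fun x : ℝ => ((z : ℂ) + I * x) ^ (n + 1) * gw x) this ?_
    rw [Nat.add_sub_cancel]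
    simp only [Pi.pow_apply]
    push_cast
    have hI : I * I = -1 := I_mul_I
    linear_combination (-gw x * (↑z + I * ↑x) ^ (n+1) * x) * hI
  have h1 := ((gw_int z n).const_mul (((n : ℂ) + 1) * I))
  have h2 := (gw_int z (n + 2)).const_mul I
  have h3 := (gw_int z (n + 1)).const_mul (I * z)
  have h := integral_eq_zero_of_hasDerivAt_of_integrable hd (h1.add (h2.sub h3)) (gw_int z (n + 1))
  rw [integral_add h1 (by exact h2.sub h3), integral_sub h2 h3, integral_const_mul, integral_const_mul,
    integral_const_mul] at h
  have hI : I * I = -1 := I_mul_I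
  generalize (∫ x : ℝ, ((z : ℂ) + I * x) ^ (n + 2) * gw x) = a at *
  generalize (∫ x : ℝ, ((z : ℂ) + I * x) ^ (n + 1) * gw x) = b at *
  generalize (∫ x : ℝ, ((z : ℂ) + I * x) ^ n * gw x) = c at *
  have hI0 := I_ne_zero
  apply mul_left_cancel₀ hI0
  linear_combination h

theorem gw_zero : ∫ x : ℝ, gw x = ((Real.sqrt (2 * Real.pi) : ℝ) : ℂ) := by
  unfold gw
  have h0 : ∫ x : ℝ, ((Real.exp (-x ^ 2 / 2) : ℝ) : ℂ) = ((∫ x : ℝ, Real.exp (-x ^ 2 / 2) : ℝ) : ℂ) :=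
    integral_ofReal
  rw [h0]
  congr 1
  have := integral_gaussian (1 / 2)
  have e : ∀ x : ℝ, -(1 / 2) * x ^ 2 = -x ^ 2 / 2 := fun x => by ring
  simp only [e] at this
  rw [this]
  congr 1; ring

theorem hermite_moment (z : ℝ) (n : ℕ) :
    ∫ x : ℝ, ((z : ℂ) + I * x) ^ n * gw x =
      ((Real.sqrt (2 * Real.pi) : ℝ) : ℂ) * ((Polynomial.aeval z (Polynomial.hermite n) : ℝ) : ℂ) := by
  have key : ∀ n : ℕ, (∫ x : ℝ, ((z : ℂ) + I * x) ^ n * gw x =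
      ((Real.sqrt (2 * Real.pi) : ℝ) : ℂ) * ((Polynomial.aeval z (Polynomial.hermite n) : ℝ) : ℂ)) ∧
      (∫ x : ℝ, ((z : ℂ) + I * x) ^ (n + 1) * gw x =
      ((Real.sqrt (2 * Real.pi) : ℝ) : ℂ) * ((Polynomial.aeval z (Polynomial.hermite (n + 1)) : ℝ) : ℂ)) := by
    intro n
    induction n with
    | zero =>
      refine ⟨by simp [gw_zero], ?_⟩
      have h1 : Integrable (fun x : ℝ => (x : ℂ) * gw x) := by
        have := (gw_int 0 1).const_mul (-I)
        refine this.congr (Filter.Eventually.of_forall fun x => ?_)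
        have hI : I * I = -1 := I_mul_I
        simp
        linear_combination (-(x:ℂ) * gw x) * hI
      have h0 : Integrable gw := by simpa using gw_int 0 0
      have h2 := integral_eq_zero_of_hasDerivAt_of_integrable gw_deriv
        (by simpa using h1.neg) h0
      have h3 : ∫ x : ℝ, (x : ℂ) * gw x = 0 := by
        simpa [integral_neg] using h2
      simp only [zero_add, pow_one, Polynomial.hermite_one, Polynomial.aeval_X, add_mul, mul_assoc]
      rw [integral_add (h0.const_mul _) (h1.const_mul _), integral_const_mul, integral_const_mul, h3,
        gw_zero]
      ring
    | succ n ih =>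
      refine ⟨ih.2, ?_⟩
      rw [gw_stein, ih.1, ih.2, Polynomial.hermite_succ (n + 1), derivative_hermite_succ']
      simp
      ring
  exact (key n).1

theorem mehler (z ρ : ℝ) (hρ : |ρ| < 1) :
    HasSum (fun n : ℕ => ρ ^ n * (Polynomial.aeval z (Polynomial.hermite n) : ℝ) ^ 2 / n.factorial)
      ((Real.sqrt (1 - ρ ^ 2))⁻¹ * Real.exp (z ^ 2 * ρ / (1 + ρ))) := by
  have hρ1 := abs_lt.mp hρ
  have hρ2 : 0 < 1 - ρ ^ 2 := by nlinarith
  have hpi := Real.pi_pos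
  set F : ℕ → ℝ × ℝ → ℂ := fun n p => (((ρ : ℂ) ^ n / n.factorial) *
    (((z : ℂ) + I * p.1) ^ n * gw p.1)) * (((z : ℂ) + I * p.2) ^ n * gw p.2) with hF
  set bd : ℕ → ℝ × ℝ → ℝ := fun n p => (|ρ| * (‖(z : ℂ) + I * p.1‖ * ‖(z : ℂ) + I * p.2‖)) ^ n / n.factorial *
    (Real.exp (-p.1 ^ 2 / 2) * Real.exp (-p.2 ^ 2 / 2)) with hbd
  have hg : ∀ x, ‖gw x‖ = Real.exp (-x ^ 2 / 2) := by
    intro x; unfold gw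
    rw [norm_real, Real.norm_of_nonneg (Real.exp_pos _).le]
  have hbs : ∀ p : ℝ × ℝ, HasSum (fun n => bd n p)
      (Real.exp (|ρ| * (‖(z : ℂ) + I * p.1‖ * ‖(z : ℂ) + I * p.2‖)) *
        (Real.exp (-p.1 ^ 2 / 2) * Real.exp (-p.2 ^ 2 / 2))) := by
    intro p
    have := NormedSpace.expSeries_div_hasSum_exp (|ρ| * (‖(z : ℂ) + I * p.1‖ * ‖(z : ℂ) + I * p.2‖))
    rw [← Real.exp_eq_exp_ℝ] at this
    exact this.mul_right _
  have hFs : ∀ p : ℝ × ℝ, HasSum (fun n => F n p)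
      (cexp (ρ * (((z : ℂ) + I * p.1) * ((z : ℂ) + I * p.2))) * (gw p.1 * gw p.2)) := by
    intro p
    have := NormedSpace.expSeries_div_hasSum_exp ((ρ : ℂ) * (((z : ℂ) + I * p.1) * ((z : ℂ) + I * p.2)))
    rw [← Complex.exp_eq_exp_ℂ] at this
    have := this.mul_right (gw p.1 * gw p.2)
    have he : (fun n => F n p) = fun i =>
        (↑ρ * ((↑z + I * ↑p.1) * (↑z + I * ↑p.2))) ^ i / ↑i.factorial * (gw p.1 * gw p.2) := by
      funext n
      simp only [hF, mul_pow]
      ring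
    rw [he]
    exact this
  have hcg : Continuous gw := by unfold gw; fun_prop
  have hbI : Integrable (fun p : ℝ × ℝ => Real.exp (|ρ| * (‖(z : ℂ) + I * p.1‖ * ‖(z : ℂ) + I * p.2‖)) *
        (Real.exp (-p.1 ^ 2 / 2) * Real.exp (-p.2 ^ 2 / 2))) (volume.prod volume) := by
    have h1 := integrable_exp_neg_mul_sq (b := (1 - |ρ|) / 2) (by linarith)
    have h2 := (h1.mul_prod h1).const_mul (Real.exp (|ρ| * z ^ 2))
    refine h2.mono' ?_ ?_
    · apply Continuous.aestronglyMeasurable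
      fun_prop
    · refine Filter.Eventually.of_forall fun p => ?_
      rw [Real.norm_of_nonneg (by positivity)]
      have hn : ∀ x : ℝ, ‖(z : ℂ) + I * x‖ ^ 2 = z ^ 2 + x ^ 2 := by
        intro x
        rw [← normSq_eq_norm_sq]
        simp [normSq_apply]; ring
      rw [← Real.exp_add, ← Real.exp_add, ← Real.exp_add, ← Real.exp_add]
      apply Real.exp_le_exp.mpr
      have h3 : ‖(z : ℂ) + I * p.1‖ * ‖(z : ℂ) + I * p.2‖ ≤ z ^ 2 + (p.1 ^ 2 + p.2 ^ 2) / 2 := by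
        nlinarith [sq_nonneg (‖(z : ℂ) + I * p.1‖ - ‖(z : ℂ) + I * p.2‖), hn p.1, hn p.2]
      have := mul_le_mul_of_nonneg_left h3 (abs_nonneg ρ)
      linarith
  have hS := hasSum_integral_of_dominated_convergence (μ := (volume : Measure ℝ).prod (volume : Measure ℝ))
    (F := F) bd
    (by
      intro n
      apply Continuous.aestronglyMeasurable
      simp only [hF]
      fun_prop)
    (by
      intro n
      refine Filter.Eventually.of_forall fun p => le_of_eq ?_
      simp only [hF, hbd, norm_mul, norm_pow, hg, norm_div, norm_real, Real.norm_eq_abs, mul_pow,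
        RCLike.norm_natCast]
      ring)
    (Filter.Eventually.of_forall fun p => (hbs p).summable)
    (by
      refine hbI.congr (Filter.Eventually.of_forall fun p => ?_)
      exact (hbs p).tsum_eq.symm)
    (Filter.Eventually.of_forall hFs)
  have hL : ∀ n, ∫ p, F n p ∂((volume : Measure ℝ).prod (volume : Measure ℝ)) =
      ((2 * Real.pi * (ρ ^ n * (Polynomial.aeval z (Polynomial.hermite n) : ℝ) ^ 2 / n.factorial) : ℝ) : ℂ) := by
    intro n
    simp only [hF]
    rw [integral_prod_mul (fun x : ℝ => ((ρ : ℂ) ^ n / n.factorial) * (((z : ℂ) + I * x) ^ n * gw x))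
      (fun x : ℝ => ((z : ℂ) + I * x) ^ n * gw x), integral_const_mul, hermite_moment]
    have h2 : ((Real.sqrt (2 * Real.pi) : ℝ) : ℂ) * ((Real.sqrt (2 * Real.pi) : ℝ) : ℂ) = 2 * Real.pi := by
      rw [← ofReal_mul, Real.mul_self_sqrt (by positivity)]; push_cast; ring
    push_cast
    rw [← h2]
    ring
  have hR : ∫ p : ℝ × ℝ, cexp (ρ * (((z : ℂ) + I * p.1) * ((z : ℂ) + I * p.2))) * (gw p.1 * gw p.2)
      ∂((volume : Measure ℝ).prod (volume : Measure ℝ)) =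
      ((2 * Real.pi * ((Real.sqrt (1 - ρ ^ 2))⁻¹ * Real.exp (z ^ 2 * ρ / (1 + ρ))) : ℝ) : ℂ) := by
    rw [integral_prod]
    · have hq : ∀ x : ℝ, ∫ y : ℝ, cexp (ρ * (((z : ℂ) + I * x) * ((z : ℂ) + I * y))) * (gw x * gw y) =
          ((Real.sqrt (2 * Real.pi) : ℝ) : ℂ) * cexp (((-(1 - ρ ^ 2) / 2 : ℝ) : ℂ) * x ^ 2
            + (I * ρ * z - I * ρ ^ 2 * z) * x + (ρ * z ^ 2 - ρ ^ 2 * z ^ 2 / 2)) := by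
        intro x
        have := integral_cexp_quadratic (b := -(1 / 2 : ℂ)) (by norm_num) (ρ * ((z : ℂ) + I * x) * I)
          (ρ * ((z : ℂ) + I * x) * z - x ^ 2 / 2)
        have hc : (Real.pi / -(-(1 / 2 : ℂ))) ^ (1 / 2 : ℂ) = ((Real.sqrt (2 * Real.pi) : ℝ) : ℂ) := by
          rw [Real.sqrt_eq_rpow, ofReal_cpow (by positivity)]
          push_cast
          congr 1
          ring
        rw [hc] at this
        convert this using 1
        · congr 1
          ext y
          unfold gw
          rw [ofReal_exp, ofReal_exp, ← Complex.exp_add, ← Complex.exp_add]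
          congr 1
          push_cast
          ring
        · congr 2
          have hI : I * I = -1 := I_mul_I
          push_cast
          linear_combination (- (ρ:ℂ)^2 * ((z : ℂ) + I * x) ^ 2 / 2 + (ρ:ℂ)^2 * x^2/2) * hI
      simp only [hq]
      rw [integral_const_mul]
      rw [integral_cexp_quadratic (by simp only [ofReal_re]; linarith)]
      have hc : (Real.pi / -((-(1 - ρ ^ 2) / 2 : ℝ) : ℂ)) ^ (1 / 2 : ℂ) =
          ((Real.sqrt (2 * Real.pi) * (Real.sqrt (1 - ρ ^ 2))⁻¹ : ℝ) : ℂ) := by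
        rw [← div_eq_mul_inv, ← Real.sqrt_div (by positivity), Real.sqrt_eq_rpow, ofReal_cpow (by positivity)]
        push_cast
        congr 1
        have : (1 - (ρ:ℂ) ^ 2) ≠ 0 := by exact_mod_cast hρ2.ne'
        rw [← neg_div, neg_neg]
        field_simp
      rw [hc]
      have h2 : ((Real.sqrt (2 * Real.pi) : ℝ) : ℂ) * ((Real.sqrt (2 * Real.pi) : ℝ) : ℂ) = 2 * Real.pi := by
        rw [← ofReal_mul, Real.mul_self_sqrt (by positivity)]; push_cast; ring
      push_cast
      rw [← h2]
      have he : (ρ * (z:ℂ) ^ 2 - ρ ^ 2 * z ^ 2 / 2) - (I * ρ * z - I * ρ ^ 2 * z) ^ 2 / (4 * (-(1 - (ρ:ℂ) ^ 2) / 2))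
          = (z:ℂ) ^ 2 * ρ / (1 + ρ) := by
        have h5 : (1 - (ρ:ℂ)) ≠ 0 := by
          have : (1 - ρ) ≠ 0 := by linarith
          exact_mod_cast this
        have h6 : (1 + (ρ:ℂ)) ≠ 0 := by
          have : (1 + ρ) ≠ 0 := by linarith
          exact_mod_cast this
        have h7 : (1 - (ρ:ℂ) ^ 2) = (1 - ρ) * (1 + ρ) := by ring
        have h8 : (I * ρ * z - I * ρ ^ 2 * z) ^ 2 = - ((ρ:ℂ) * z * (1 - ρ)) ^ 2 := by
          linear_combination ((ρ:ℂ) * z * (1 - ρ)) ^ 2 * I_mul_I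
        rw [h7, h8]
        field_simp
        ring
      rw [he]
      ring
    · refine hbI.mono' ?_ ?_
      · apply Continuous.aestronglyMeasurable
        fun_prop
      · refine Filter.Eventually.of_forall fun p => ?_
        rw [norm_mul, norm_mul, hg, hg]
        gcongr
        refine (Complex.norm_exp_le_exp_norm _).trans (Real.exp_le_exp.mpr ?_)
        rw [norm_mul, norm_mul, norm_real, Real.norm_eq_abs]
  simp only [hL, hR] at hS
  have hS2 := (hasSum_ofReal.mp hS).mul_left (2 * Real.pi)⁻¹
  have hne : (2 * Real.pi) ≠ 0 := by positivity
  simpa only [← mul_assoc, inv_mul_cancel₀ hne, one_mul, inv_mul_cancel_left₀ hne] using hS2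

noncomputable def G0 (z r : ℝ) : ℝ := (√(1 - r ^ 2))⁻¹ * Real.exp (-(z ^ 2 * r / (1 - r)))

theorem M_int (z : ℝ) {σ : ℝ} (hσ : 0 < σ) :
    IntegrableOn (fun r : ℝ => (√(1 - r ^ 2))⁻¹ * Real.exp (z ^ 2 * r / (1 + r)) * r ^ (σ - 1)) (Ioo 0 1) := by
  have hb := betaIntegral_convergent (u := (σ : ℂ)) (v := ((1/2 : ℝ) : ℂ)) (by simpa) (by simp)
  rw [intervalIntegrable_iff_integrableOn_Ioo_of_le zero_le_one] at hb
  refine Integrable.mono' (hb.norm.const_mul (Real.exp (z ^ 2))) ?_ ?_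
  · apply Measurable.aestronglyMeasurable
    fun_prop
  · refine (ae_restrict_iff' measurableSet_Ioo).mpr (Filter.Eventually.of_forall fun r hr => ?_)
    obtain ⟨h0, h1⟩ := hr
    have hr1 : 0 < 1 - r := by linarith
    rw [Real.norm_of_nonneg (by positivity), norm_mul]
    have e0 : (1 - (r : ℂ)) = ((1 - r : ℝ) : ℂ) := by push_cast; ring
    rw [norm_cpow_eq_rpow_re_of_pos h0, e0, norm_cpow_eq_rpow_re_of_pos hr1]
    have e1 : ((σ : ℂ) - 1).re = σ - 1 := by simp
    have e2 : (((1/2 : ℝ) : ℂ) - 1).re = -(1/2) := by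
      rw [sub_re, ofReal_re, one_re]; norm_num
    rw [e1, e2, Real.rpow_neg hr1.le, ← Real.sqrt_eq_rpow]
    have h2 : (√(1 - r ^ 2))⁻¹ ≤ (√(1 - r))⁻¹ := by
      have : 0 < √(1 - r) := Real.sqrt_pos.mpr hr1
      gcongr
      nlinarith
    have h3 : Real.exp (z ^ 2 * r / (1 + r)) ≤ Real.exp (z ^ 2) := by
      gcongr
      rw [div_le_iff₀ (by linarith)]
      nlinarith [sq_nonneg z]
    have h4 : 0 ≤ r ^ (σ - 1) := by positivity
    calc _ ≤ (√(1 - r))⁻¹ * Real.exp (z ^ 2) * r ^ (σ - 1) := by gcongr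
      _ = _ := by ring

theorem series_int (z : ℝ) (ν : ℂ) (hν : 0 < ν.re) :
    HasSum (fun n : ℕ =>
      (-1 : ℂ)^n * (((Polynomial.aeval z) (Polynomial.hermite n) : ℝ) : ℂ)^2 /
        ((n.factorial : ℂ) * ((n : ℂ) + ν)))
      (∫ r in Ioo (0:ℝ) 1, (G0 z r : ℂ) * (r : ℂ) ^ (ν - 1)) := by
  set c : ℕ → ℝ := fun n => (Polynomial.aeval z (Polynomial.hermite n) : ℝ) ^ 2 / n.factorial with hc
  have hcn : ∀ n, 0 ≤ c n := fun n => by simp only [hc]; positivity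
  have hM : ∀ r ∈ Ioo (0:ℝ) 1, HasSum (fun n => c n * r ^ n * r ^ (ν.re - 1))
      ((√(1 - r ^ 2))⁻¹ * Real.exp (z ^ 2 * r / (1 + r)) * r ^ (ν.re - 1)) := by
    intro r hr
    have := (mehler z r (by rw [abs_of_pos hr.1]; exact hr.2)).mul_right (r ^ (ν.re - 1))
    have e : (fun n => c n * r ^ n * r ^ (ν.re - 1)) = fun i =>
        r ^ i * (Polynomial.aeval z (Polynomial.hermite i) : ℝ) ^ 2 / i.factorial * r ^ (ν.re - 1) := by
      funext n; simp only [hc]; ring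
    rw [e]
    exact this
  have hG : ∀ r ∈ Ioo (0:ℝ) 1, HasSum (fun n : ℕ => ((-1 : ℂ) ^ n * c n) * (r : ℂ) ^ ((n : ℂ) + ν - 1))
      ((G0 z r : ℂ) * (r : ℂ) ^ (ν - 1)) := by
    intro r hr
    have h1 := mehler z (-r) (by rw [abs_neg, abs_of_pos hr.1]; exact hr.2)
    have h2 := (hasSum_ofReal.mpr h1).mul_right ((r : ℂ) ^ (ν - 1))
    have e : (fun n : ℕ => ((-1 : ℂ) ^ n * c n) * (r : ℂ) ^ ((n : ℂ) + ν - 1)) = fun i : ℕ =>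
        (((-r) ^ i * (Polynomial.aeval z (Polynomial.hermite i) : ℝ) ^ 2 / i.factorial : ℝ) : ℂ) *
          (r : ℂ) ^ (ν - 1) := by
      funext n
      have hr0 : (r : ℂ) ≠ 0 := by exact_mod_cast hr.1.ne'
      rw [add_sub_assoc, cpow_add _ _ hr0, cpow_natCast]
      simp only [hc]
      push_cast
      rw [neg_pow (r : ℂ) n]
      ring
    rw [e]
    have e2 : (√(1 - (-r) ^ 2))⁻¹ * Real.exp (z ^ 2 * -r / (1 + -r)) = G0 z r := by
      unfold G0
      rw [neg_sq, mul_neg, neg_div, ← sub_eq_add_neg]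
    rw [e2] at h2
    exact h2
  have hS := hasSum_integral_of_dominated_convergence (μ := volume.restrict (Ioo (0:ℝ) 1))
    (F := fun (n : ℕ) (r : ℝ) => ((-1 : ℂ) ^ n * c n) * (r : ℂ) ^ ((n : ℂ) + ν - 1))
    (f := fun r : ℝ => (G0 z r : ℂ) * (r : ℂ) ^ (ν - 1))
    (fun n r => c n * r ^ n * r ^ (ν.re - 1))
    (by
      intro n
      apply Measurable.aestronglyMeasurable
      fun_prop)
    (by
      intro n
      refine (ae_restrict_iff' measurableSet_Ioo).mpr (Filter.Eventually.of_forall fun r hr => ?_)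
      rw [norm_mul, norm_mul, norm_cpow_eq_rpow_re_of_pos hr.1, norm_pow, norm_neg, norm_one, one_pow,
        one_mul, norm_real, Real.norm_of_nonneg (hcn n), mul_assoc]
      apply le_of_eq
      congr 1
      rw [add_sub_assoc, add_re, natCast_re, Real.rpow_add hr.1, Real.rpow_natCast, sub_re, one_re])
    ((ae_restrict_iff' measurableSet_Ioo).mpr (Filter.Eventually.of_forall fun r hr => (hM r hr).summable))
    ((M_int z hν).congr_fun (fun r hr => (hM r hr).tsum_eq.symm) measurableSet_Ioo)
    ((ae_restrict_iff' measurableSet_Ioo).mpr (Filter.Eventually.of_forall fun r hr => hG r hr))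
  have e : ∀ n : ℕ, ∫ r in Ioo (0:ℝ) 1, ((-1 : ℂ) ^ n * c n) * (r : ℂ) ^ ((n : ℂ) + ν - 1) =
      (-1 : ℂ)^n * (((Polynomial.aeval z) (Polynomial.hermite n) : ℝ) : ℂ)^2 /
        ((n.factorial : ℂ) * ((n : ℂ) + ν)) := by
    intro n
    have hre : 0 < ((n : ℂ) + ν).re := by
      rw [add_re, natCast_re]; positivity
    have hne : (n : ℂ) + ν ≠ 0 := by
      intro h; rw [h] at hre; simp at hre
    rw [integral_const_mul, ← integral_Ioc_eq_integral_Ioo, ← intervalIntegral.integral_of_le zero_le_one,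
      integral_cpow (Or.inl (by rw [sub_re, one_re]; linarith))]
    rw [sub_add_cancel, ofReal_one, one_cpow, ofReal_zero, zero_cpow hne]
    simp only [hc]
    push_cast
    field_simp
    ring
  simpa only [e] using hS

theorem G0_int (z : ℝ) {ν : ℂ} (hν : 0 < ν.re) :
    IntegrableOn (fun r : ℝ => (G0 z r : ℂ) * (r : ℂ) ^ (ν - 1)) (Ioo 0 1) := by
  refine Integrable.mono' (M_int z hν) ?_ ?_
  · apply Measurable.aestronglyMeasurable
    unfold G0
    fun_prop
  · refine (ae_restrict_iff' measurableSet_Ioo).mpr (Filter.Eventually.of_forall fun r hr => ?_)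
    obtain ⟨h0, h1⟩ := hr
    have hr1 : 0 < 1 - r := by linarith
    unfold G0
    rw [norm_mul, norm_cpow_eq_rpow_re_of_pos h0, norm_real, Real.norm_of_nonneg (by positivity),
      sub_re, one_re]
    gcongr
    have h2 : 0 ≤ z ^ 2 * r / (1 - r) := by positivity
    have h3 : 0 ≤ z ^ 2 * r / (1 + r) := by positivity
    linarith

theorem subst_aux {a c : ℝ} (ha : 0 < a) (hc : 0 < c) :
    (∀ t ∈ Ioi (0:ℝ), HasDerivWithinAt (fun t : ℝ => a * t - c / t) (a + c / t ^ 2) (Ioi 0) t) ∧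
    InjOn (fun t : ℝ => a * t - c / t) (Ioi 0) ∧
    (fun t : ℝ => a * t - c / t) '' (Ioi 0) = univ := by
  refine ⟨?_, ?_, ?_⟩
  · intro t ht
    have ht' : t ≠ 0 := ne_of_gt ht
    have h1 := (hasDerivAt_id t).const_mul a
    have h2 := (hasDerivAt_inv ht').const_mul c
    refine HasDerivAt.hasDerivWithinAt ?_
    refine HasDerivAt.congr_deriv (f := fun t : ℝ => a * t - c / t) (h1.sub h2) ?_
    field_simp
    ring
  · intro s hs t ht h
    have hs' : 0 < s := hs
    have ht' : 0 < t := ht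
    simp only at h
    have h3 : (s - t) * (a + c / (s * t)) = 0 := by
      field_simp at h ⊢
      linarith
    rcases mul_eq_zero.mp h3 with h4 | h4
    · linarith
    · have : 0 < a + c / (s * t) := by positivity
      linarith
  · refine eq_univ_of_forall fun u => ?_
    have hR : u ^ 2 < u ^ 2 + 4 * a * c := by nlinarith [mul_pos ha hc]
    have hR2 : |u| < √(u ^ 2 + 4 * a * c) := by
      rw [← Real.sqrt_sq_eq_abs]; exact Real.sqrt_lt_sqrt (sq_nonneg _) hR
    have hR3 : √(u ^ 2 + 4 * a * c) ^ 2 = u ^ 2 + 4 * a * c := Real.sq_sqrt (by positivity)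
    have hpos : 0 < u + √(u ^ 2 + 4 * a * c) := by
      have := neg_abs_le u; linarith
    refine ⟨(u + √(u ^ 2 + 4 * a * c)) / (2 * a), by simp only [mem_Ioi]; positivity, ?_⟩
    simp only
    generalize √(u ^ 2 + 4 * a * c) = R at *
    field_simp
    nlinarith

theorem subst_int {a c : ℝ} (ha : 0 < a) (hc : 0 < c) (g : ℝ → ℝ) :
    ∫ u, g u = ∫ t in Ioi (0:ℝ), (a + c / t ^ 2) * g (a * t - c / t) := by
  obtain ⟨h1, h2, h3⟩ := subst_aux ha hc
  have := integral_image_eq_integral_abs_deriv_smul measurableSet_Ioi h1 h2 g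
  rw [h3, setIntegral_univ] at this
  rw [this]
  refine setIntegral_congr_fun measurableSet_Ioi fun t ht => ?_
  have ht' : 0 < t := ht
  simp only [smul_eq_mul]
  rw [abs_of_pos (by positivity)]

theorem subst_integrable {a c : ℝ} (ha : 0 < a) (hc : 0 < c) {g : ℝ → ℝ} (hg : Integrable g) :
    IntegrableOn (fun t => (a + c / t ^ 2) * g (a * t - c / t)) (Ioi (0:ℝ)) := by
  obtain ⟨h1, h2, h3⟩ := subst_aux ha hc
  have := integrableOn_image_iff_integrableOn_abs_deriv_smul measurableSet_Ioi h1 h2 g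
  rw [h3, integrableOn_univ] at this
  refine (this.mp hg).congr_fun (fun t ht => ?_) measurableSet_Ioi
  have ht' : 0 < t := ht
  simp only [smul_eq_mul]
  rw [abs_of_pos (by positivity)]

theorem gauss_half : ∫ x : ℝ, Real.exp (-x ^ 2 / 2) = √(2 * Real.pi) := by
  have := integral_gaussian (1 / 2)
  have e : ∀ x : ℝ, -(1 / 2) * x ^ 2 = -x ^ 2 / 2 := fun x => by ring
  simp only [e] at this
  rw [this]
  congr 1; ring

theorem gauss_half_int : Integrable (fun x : ℝ => Real.exp (-x ^ 2 / 2)) := by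
  have := integrable_exp_neg_mul_sq (b := 1 / 2) (by norm_num)
  have e : ∀ x : ℝ, -(1 / 2) * x ^ 2 = -x ^ 2 / 2 := fun x => by ring
  simpa only [e] using this

theorem laplace_int {R z : ℝ} (hR : 0 < R) (hz : 0 ≤ z) :
    ∫ t in Ioi (0:ℝ), Real.exp (-(R ^ 2 * t ^ 2 / 2 + z ^ 2 / (2 * t ^ 2))) =
      √(2 * Real.pi) / (2 * R) * Real.exp (-z * R) := by
  rcases hz.eq_or_lt with rfl | hz
  · have h := integral_gaussian_Ioi (R ^ 2 / 2)
    have e : ∀ t : ℝ, -(R ^ 2 * t ^ 2 / 2 + 0 ^ 2 / (2 * t ^ 2)) = -(R ^ 2 / 2) * t ^ 2 :=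
      fun t => by ring
    simp only [e, h]
    rw [show Real.pi / (R ^ 2 / 2) = (2 * Real.pi) / R ^ 2 by field_simp,
      Real.sqrt_div (by positivity), Real.sqrt_sq hR.le]
    simp
    field_simp
  · set E : ℝ → ℝ := fun t => Real.exp (-(R * t - z / t) ^ 2 / 2) with hE
    have h1 := subst_int hR hz (fun x => Real.exp (-x ^ 2 / 2))
    have h2 := subst_integrable hR hz gauss_half_int
    rw [gauss_half] at h1
    have hEm : Measurable E := by simp only [hE]; fun_prop
    have hi1 : IntegrableOn (fun t => R * E t) (Ioi 0) := by
      refine Integrable.mono' h2 (by fun_prop) ?_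
      refine (ae_restrict_iff' measurableSet_Ioi).mpr (Filter.Eventually.of_forall fun t ht => ?_)
      have ht' : 0 < t := ht
      rw [Real.norm_of_nonneg (by positivity)]
      simp only [hE]
      gcongr
      have : 0 < z / t ^ 2 := by positivity
      linarith
    have hi2 : IntegrableOn (fun t => z / t ^ 2 * E t) (Ioi 0) := by
      refine Integrable.mono' h2 (by fun_prop) ?_
      refine (ae_restrict_iff' measurableSet_Ioi).mpr (Filter.Eventually.of_forall fun t ht => ?_)
      have ht' : 0 < t := ht
      rw [Real.norm_of_nonneg (by positivity)]
      simp only [hE]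
      gcongr
      linarith
    have h3 : ∫ t in Ioi (0:ℝ), E t = ∫ t in Ioi (0:ℝ), R⁻¹ * (z / t ^ 2 * E t) := by
      have hd : ∀ t ∈ Ioi (0:ℝ), HasDerivWithinAt (fun t : ℝ => (z / R) * t⁻¹) ((z / R) * (-(t ^ 2)⁻¹)) (Ioi 0) t := by
        intro t ht
        exact ((hasDerivAt_inv (ne_of_gt ht)).const_mul (z / R)).hasDerivWithinAt
      have hinj : InjOn (fun t : ℝ => (z / R) * t⁻¹) (Ioi 0) := by
        intro s hs t ht h
        have hzR : z / R ≠ 0 := by positivity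
        exact inv_injective (mul_left_cancel₀ hzR h)
      have him : (fun t : ℝ => (z / R) * t⁻¹) '' (Ioi 0) = Ioi 0 := by
        ext u
        constructor
        · rintro ⟨t, ht, rfl⟩
          have ht' : 0 < t := ht
          simp only [mem_Ioi]; positivity
        · intro hu
          have hu' : 0 < u := hu
          refine ⟨(z / R) * u⁻¹, by simp only [mem_Ioi]; positivity, ?_⟩
          simp only
          field_simp
      have := integral_image_eq_integral_abs_deriv_smul measurableSet_Ioi hd hinj E
      rw [him] at this
      rw [this]
      refine setIntegral_congr_fun measurableSet_Ioi fun t ht => ?_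
      have ht' : 0 < t := ht
      simp only [smul_eq_mul]
      rw [abs_mul, abs_neg, abs_of_pos (by positivity), abs_of_pos (by positivity)]
      have : E (z / R * t⁻¹) = E t := by
        simp only [hE]
        congr 2
        field_simp
        ring
      rw [this]
      field_simp
    rw [integral_const_mul] at h3
    have h4 : √(2 * Real.pi) = (∫ t in Ioi (0:ℝ), R * E t) + ∫ t in Ioi (0:ℝ), z / t ^ 2 * E t := by
      rw [h1, ← integral_add hi1 hi2]
      congr 1
      ext t
      simp only [hE]; ring
    rw [integral_const_mul] at h4
    have h5 : ∫ t in Ioi (0:ℝ), Real.exp (-(R ^ 2 * t ^ 2 / 2 + z ^ 2 / (2 * t ^ 2))) =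
        ∫ t in Ioi (0:ℝ), E t * Real.exp (-z * R) := by
      refine setIntegral_congr_fun measurableSet_Ioi fun t ht => ?_
      have ht' : 0 < t := ht
      simp only [hE]
      rw [← Real.exp_add]
      congr 1
      field_simp
      ring
    rw [h5, integral_mul_const]
    congr 1
    rw [h4]
    have : (∫ t in Ioi (0:ℝ), z / t ^ 2 * E t) = R * ∫ t in Ioi (0:ℝ), E t := by
      rw [h3]; field_simp
    rw [this]
    field_simp
    ring

theorem kern1 {z p : ℝ} (hp : 0 < p) :
    ∫ s in Ioi (0:ℝ), Real.exp (-z * s - s ^ 2 / 2) * Real.exp (-z * (p / s) - (p / s) ^ 2 / 2) / s =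
      ∫ u : ℝ, Real.exp (-p) * Real.exp (-u ^ 2 / 2) * Real.exp (-z * √(u ^ 2 + 4 * p)) / √(u ^ 2 + 4 * p) := by
  rw [subst_int one_pos hp]
  refine setIntegral_congr_fun measurableSet_Ioi fun s hs => ?_
  have hs' : 0 < s := hs
  have hR : √((1 * s - p / s) ^ 2 + 4 * p) = s + p / s := by
    rw [show (1 * s - p / s) ^ 2 + 4 * p = (s + p / s) ^ 2 by field_simp; ring]
    exact Real.sqrt_sq (by positivity)
  rw [hR, ← Real.exp_add, ← Real.exp_add, ← Real.exp_add]
  have e : -z * s - s ^ 2 / 2 + (-z * (p / s) - (p / s) ^ 2 / 2) =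
    -p + -(1 * s - p / s) ^ 2 / 2 + -z * (s + p / s) := by field_simp; ring
  rw [e]
  generalize Real.exp _ = q
  field_simp

theorem kern2 {z p : ℝ} (hz : 0 ≤ z) (hp : 0 < p) :
    ∫ r in Ioo (0:ℝ) 1, (√(1 - r ^ 2))⁻¹ * Real.exp (-(z ^ 2 * r / (1 - r))) * Real.exp (-(p / r)) / r =
      ∫ u : ℝ, Real.exp (-p) * Real.exp (-u ^ 2 / 2) * Real.exp (-z * √(u ^ 2 + 4 * p)) / √(u ^ 2 + 4 * p) := by
  have hpi := Real.pi_pos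
  have hd : ∀ t ∈ Ioi (0:ℝ), HasDerivWithinAt (fun t : ℝ => (1 + 2 * t ^ 2)⁻¹)
      (-(4 * t) / (1 + 2 * t ^ 2) ^ 2) (Ioi 0) t := by
    intro t ht
    have h1 : HasDerivAt (fun t : ℝ => 1 + 2 * t ^ 2) (4 * t) t := by
      have := (((hasDerivAt_id t).pow 2).const_mul 2).const_add 1
      refine HasDerivAt.congr_deriv (f := fun t : ℝ => 1 + 2 * t ^ 2) this ?_
      simp; ring
    exact (h1.inv (by positivity)).hasDerivWithinAt
  have hinj : InjOn (fun t : ℝ => (1 + 2 * t ^ 2)⁻¹) (Ioi 0) := by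
    intro s hs t ht h
    have hs' : 0 < s := hs
    have ht' : 0 < t := ht
    have := inv_injective h
    have h2 : s ^ 2 = t ^ 2 := by linarith
    exact (sq_eq_sq₀ hs'.le ht'.le).mp h2
  have him : (fun t : ℝ => (1 + 2 * t ^ 2)⁻¹) '' (Ioi 0) = Ioo 0 1 := by
    ext r
    constructor
    · rintro ⟨t, ht, rfl⟩
      have ht' : 0 < t := ht
      refine ⟨by positivity, inv_lt_one_of_one_lt₀ ?_⟩
      have : 0 < t ^ 2 := by positivity
      linarith
    · rintro ⟨h0, h1⟩
      have h2 : 0 < (r⁻¹ - 1) / 2 := by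
        have := (one_lt_inv₀ h0).mpr h1
        linarith
      refine ⟨√((r⁻¹ - 1) / 2), Real.sqrt_pos.mpr h2, ?_⟩
      simp only
      rw [Real.sq_sqrt h2.le]
      rw [show 1 + 2 * ((r⁻¹ - 1) / 2) = r⁻¹ by ring, inv_inv]
  rw [← him, integral_image_eq_integral_abs_deriv_smul measurableSet_Ioi hd hinj]
  have step1 : ∀ t ∈ Ioi (0:ℝ), |-(4 * t) / (1 + 2 * t ^ 2) ^ 2| • ((√(1 - ((1 + 2 * t ^ 2)⁻¹) ^ 2))⁻¹ *
      Real.exp (-(z ^ 2 * (1 + 2 * t ^ 2)⁻¹ / (1 - (1 + 2 * t ^ 2)⁻¹))) * Real.exp (-(p / (1 + 2 * t ^ 2)⁻¹)) /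
      (1 + 2 * t ^ 2)⁻¹) = ∫ u : ℝ, 2 * Real.exp (-p) * (√(2 * Real.pi))⁻¹ * (Real.exp (-(2 * p * t ^ 2 + z ^ 2 / (2 * t ^ 2))) *
        Real.exp (-((1 + t ^ 2) / 2) * u ^ 2)) := by
    intro t ht
    have ht' : 0 < t := ht
    rw [integral_const_mul, integral_const_mul, integral_gaussian]
    rw [show Real.pi / ((1 + t ^ 2) / 2) = (2 * Real.pi) / (1 + t ^ 2) by field_simp,
      Real.sqrt_div (by positivity)]
    rw [smul_eq_mul, neg_div, abs_neg, abs_of_pos (by positivity)]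
    have h1 : √(1 - ((1 + 2 * t ^ 2)⁻¹) ^ 2) = 2 * t * √(1 + t ^ 2) / (1 + 2 * t ^ 2) := by
      rw [show 1 - ((1 + 2 * t ^ 2)⁻¹) ^ 2 = (2 * t / (1 + 2 * t ^ 2)) ^ 2 * (1 + t ^ 2) by field_simp; ring,
        Real.sqrt_mul (by positivity), Real.sqrt_sq (by positivity)]
      ring
    have h2 : z ^ 2 * (1 + 2 * t ^ 2)⁻¹ / (1 - (1 + 2 * t ^ 2)⁻¹) = z ^ 2 / (2 * t ^ 2) := by
      rw [show 1 - (1 + 2 * t ^ 2)⁻¹ = 2 * t ^ 2 / (1 + 2 * t ^ 2) by field_simp; ring]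
      field_simp
    have h3 : Real.exp (-(z ^ 2 / (2 * t ^ 2))) * Real.exp (-(p / (1 + 2 * t ^ 2)⁻¹)) =
        Real.exp (-p) * Real.exp (-(2 * p * t ^ 2 + z ^ 2 / (2 * t ^ 2))) := by
      rw [← Real.exp_add, ← Real.exp_add]
      congr 1
      field_simp
      ring
    rw [h1, h2, mul_assoc _ (Real.exp _) (Real.exp _), h3]
    have hs1 : 0 < √(1 + t ^ 2) := by positivity
    have hs2 : 0 < √(2 * Real.pi) := by positivity
    generalize Real.exp _ = q
    generalize Real.exp _ = q'
    field_simp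
    ring
  rw [setIntegral_congr_fun measurableSet_Ioi step1]
  rw [integral_integral_swap]
  · congr 1
    ext u
    have hR : 0 < √(u ^ 2 + 4 * p) := by positivity
    have hR2 : √(u ^ 2 + 4 * p) ^ 2 = u ^ 2 + 4 * p := Real.sq_sqrt (by positivity)
    have hL := laplace_int hR hz
    rw [hR2] at hL
    have e : ∀ t : ℝ, Real.exp (-(2 * p * t ^ 2 + z ^ 2 / (2 * t ^ 2))) * Real.exp (-((1 + t ^ 2) / 2) * u ^ 2) =
        Real.exp (-u ^ 2 / 2) * Real.exp (-((u ^ 2 + 4 * p) * t ^ 2 / 2 + z ^ 2 / (2 * t ^ 2))) := by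
      intro t
      rw [← Real.exp_add, ← Real.exp_add]
      congr 1
      ring
    simp only [e]
    rw [integral_const_mul, integral_const_mul, hL]
    have hs2 : 0 < √(2 * Real.pi) := by positivity
    field_simp
  · have h1 : IntegrableOn (fun t : ℝ => Real.exp (-(2 * p) * t ^ 2)) (Ioi 0) :=
      (integrable_exp_neg_mul_sq (by positivity)).integrableOn
    have h2 := (Integrable.mul_prod h1 gauss_half_int).const_mul (2 * Real.exp (-p) * (√(2 * Real.pi))⁻¹)
    refine h2.mono' ?_ ?_
    · apply Measurable.aestronglyMeasurable
      unfold Function.uncurry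
      fun_prop
    · refine Filter.Eventually.of_forall fun q => ?_
      simp only [Function.uncurry]
      rw [Real.norm_of_nonneg (by positivity)]
      gcongr
      · have : 0 ≤ z ^ 2 / (2 * q.1 ^ 2) := by positivity
        linarith
      · nlinarith [mul_nonneg (sq_nonneg q.1) (sq_nonneg q.2)]

theorem mellin_conv {f g : ℝ → ℝ} (hfm : Measurable f) (hgm : Measurable g) (ν : ℂ)
    (hf : IntegrableOn (fun t : ℝ => (f t : ℂ) * (t : ℂ) ^ (ν - 1)) (Ioi 0))
    (hg : IntegrableOn (fun t : ℝ => (g t : ℂ) * (t : ℂ) ^ (ν - 1)) (Ioi 0)) :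
    (∫ t in Ioi (0:ℝ), (f t : ℂ) * (t : ℂ) ^ (ν - 1)) * (∫ t in Ioi (0:ℝ), (g t : ℂ) * (t : ℂ) ^ (ν - 1)) =
      ∫ p in Ioi (0:ℝ), ((∫ s in Ioi (0:ℝ), f s * g (p / s) / s : ℝ) : ℂ) * (p : ℂ) ^ (ν - 1) := by
  set φ : ℝ → ℂ := fun t => (f t : ℂ) * (t : ℂ) ^ (ν - 1) with hφ
  set ψ : ℝ → ℂ := fun t => (g t : ℂ) * (t : ℂ) ^ (ν - 1) with hψ
  have hφm : Measurable φ := by simp only [hφ]; fun_prop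
  have hψm : Measurable ψ := by simp only [hψ]; fun_prop
  set H : ℝ → ℝ → ℂ := fun s p => φ s * ((s⁻¹ : ℝ) * ψ (s⁻¹ * p)) with hH
  have hin : ∀ s ∈ Ioi (0:ℝ), ∫ p in Ioi (0:ℝ), H s p = φ s * ∫ t in Ioi (0:ℝ), ψ t := by
    intro s hs
    have hs' : 0 < s := hs
    simp only [hH]
    rw [integral_const_mul, integral_const_mul, integral_comp_mul_left_Ioi ψ 0 (inv_pos.mpr hs')]
    have : (s : ℂ) ≠ 0 := by exact_mod_cast hs'.ne'
    rw [mul_zero, inv_inv, real_smul, ofReal_inv]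
    field_simp
  have hinN : ∀ s ∈ Ioi (0:ℝ), ∫ p in Ioi (0:ℝ), ‖H s p‖ = ‖φ s‖ * ∫ t in Ioi (0:ℝ), ‖ψ t‖ := by
    intro s hs
    have hs' : 0 < s := hs
    simp only [hH, norm_mul]
    rw [integral_const_mul, integral_const_mul,
      integral_comp_mul_left_Ioi (fun t => ‖ψ t‖) 0 (inv_pos.mpr hs')]
    rw [mul_zero, inv_inv, smul_eq_mul, norm_real, Real.norm_of_nonneg (by positivity)]
    field_simp
  have hHint : Integrable (Function.uncurry H)
      ((volume.restrict (Ioi (0:ℝ))).prod (volume.restrict (Ioi (0:ℝ)))) := by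
    rw [integrable_prod_iff]
    · constructor
      · refine (ae_restrict_iff' measurableSet_Ioi).mpr (Filter.Eventually.of_forall fun s hs => ?_)
        have hs' : 0 < s := hs
        have := (integrableOn_Ioi_comp_mul_left_iff ψ 0 (inv_pos.mpr hs')).mpr (by rwa [mul_zero])
        exact (this.const_mul ((s⁻¹ : ℝ) : ℂ)).const_mul (φ s)
      · have : IntegrableOn (fun s => ‖φ s‖ * ∫ t in Ioi (0:ℝ), ‖ψ t‖) (Ioi 0) := hf.norm.mul_const _
        exact this.congr_fun (fun s hs => (hinN s hs).symm) measurableSet_Ioi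
    · apply Measurable.aestronglyMeasurable
      simp only [Function.uncurry_def, hH]
      fun_prop
  rw [← integral_mul_const, ← setIntegral_congr_fun measurableSet_Ioi hin, integral_integral_swap hHint]
  refine setIntegral_congr_fun measurableSet_Ioi fun p hp => ?_
  have hp' : 0 < p := hp
  have h0 : ((∫ s in Ioi (0:ℝ), f s * g (p / s) / s : ℝ) : ℂ) =
      ∫ s in Ioi (0:ℝ), ((f s * g (p / s) / s : ℝ) : ℂ) := integral_ofReal.symm
  rw [h0, ← integral_mul_const]
  refine setIntegral_congr_fun measurableSet_Ioi fun s hs => ?_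
  have hs' : 0 < s := hs
  simp only [hH, hφ, hψ]
  have h1 : (p : ℂ) ^ (ν - 1) = (s : ℂ) ^ (ν - 1) * ((s⁻¹ * p : ℝ) : ℂ) ^ (ν - 1) := by
    rw [← mul_cpow_ofReal_nonneg hs'.le (by positivity), ← ofReal_mul, mul_inv_cancel_left₀ hs'.ne']
  rw [h1, show s⁻¹ * p = p / s by rw [div_eq_inv_mul]]
  push_cast
  ring

theorem main_aux (z : ℝ) (hz : 0 ≤ z) (ν : ℂ) (hν : 0 < ν.re) :
    (∫ t in Ioi (0:ℝ), Complex.exp (-(z:ℂ) * t - (t:ℂ)^2 / 2) * (t:ℂ) ^ (ν - 1)) ^ 2 =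
    Complex.Gamma ν * ∫ r in Ioo (0:ℝ) 1, (G0 z r : ℂ) * (r : ℂ) ^ (ν - 1) := by
  set h : ℝ → ℝ := fun t => Real.exp (-z * t - t ^ 2 / 2) with hh
  have e1 : ∀ t : ℝ, Complex.exp (-(z:ℂ) * t - (t:ℂ)^2 / 2) * (t:ℂ) ^ (ν - 1) = (h t : ℂ) * (t:ℂ) ^ (ν - 1) := by
    intro t
    simp only [hh]
    push_cast
    rfl
  have hhm : Measurable h := by simp only [hh]; fun_prop
  have hhi : IntegrableOn (fun t : ℝ => (h t : ℂ) * (t : ℂ) ^ (ν - 1)) (Ioi 0) := by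
    refine Integrable.mono' (integrableOn_rpow_mul_exp_neg_mul_sq (b := 1 / 2) (by norm_num)
      (s := ν.re - 1) (by linarith)) (Measurable.aestronglyMeasurable (by fun_prop)) ?_
    refine (ae_restrict_iff' measurableSet_Ioi).mpr (Filter.Eventually.of_forall fun t ht => ?_)
    have ht' : 0 < t := ht
    simp only [hh]
    rw [norm_mul, norm_cpow_eq_rpow_re_of_pos ht', norm_real, Real.norm_of_nonneg (Real.exp_pos _).le,
      sub_re, one_re, mul_comm]
    gcongr
    nlinarith
  set g : ℝ → ℝ := (Ioo (0:ℝ) 1).indicator (G0 z) with hg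
  have hgm : Measurable g := by
    refine Measurable.indicator ?_ measurableSet_Ioo
    unfold G0; fun_prop
  have e2 : (fun t : ℝ => (g t : ℂ) * (t : ℂ) ^ (ν - 1)) =
      (Ioo (0:ℝ) 1).indicator (fun t : ℝ => (G0 z t : ℂ) * (t : ℂ) ^ (ν - 1)) := by
    funext t
    simp only [hg, indicator]
    split_ifs <;> simp
  have hgi : IntegrableOn (fun t : ℝ => (g t : ℂ) * (t : ℂ) ^ (ν - 1)) (Ioi 0) := by
    rw [e2]
    exact ((integrable_indicator_iff measurableSet_Ioo).mpr (G0_int z hν)).integrableOn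
  have hsub : Ioi (0:ℝ) ∩ Ioo 0 1 = Ioo 0 1 := inter_eq_right.mpr Ioo_subset_Ioi_self
  have e3 : ∫ t in Ioi (0:ℝ), (g t : ℂ) * (t : ℂ) ^ (ν - 1) =
      ∫ r in Ioo (0:ℝ) 1, (G0 z r : ℂ) * (r : ℂ) ^ (ν - 1) := by
    rw [e2, setIntegral_indicator measurableSet_Ioo, hsub]
  have e4 : Complex.Gamma ν = ∫ t in Ioi (0:ℝ), ((Real.exp (-t) : ℝ) : ℂ) * (t : ℂ) ^ (ν - 1) := by
    rw [Gamma_eq_integral hν]; rfl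
  have hei := GammaIntegral_convergent hν
  have h1 := mellin_conv hhm hhm ν hhi hhi
  have h2 := mellin_conv (g := fun t => Real.exp (-t)) hgm (by fun_prop) ν hgi hei
  simp only [e1]
  rw [sq, h1, mul_comm, ← e3, e4, h2]
  refine setIntegral_congr_fun measurableSet_Ioi fun p hp => ?_
  have hp' : 0 < p := hp
  congr 2
  have h3 : ∫ s in Ioi (0:ℝ), g s * Real.exp (-(p / s)) / s =
      ∫ s in Ioo (0:ℝ) 1, G0 z s * Real.exp (-(p / s)) / s := by
    have e5 : (fun s => g s * Real.exp (-(p / s)) / s) =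
        (Ioo (0:ℝ) 1).indicator (fun s => G0 z s * Real.exp (-(p / s)) / s) := by
      funext t
      simp only [hg, indicator]
      split_ifs <;> simp
    rw [e5, setIntegral_indicator measurableSet_Ioo, hsub]
  rw [h3]
  exact (kern1 hp').trans (kern2 hz hp').symm

theorem square_parabolic_cylinder_hermite_series
    (z : ℝ) (hz : 0 ≤ z) (ν : ℂ) (hν : 0 < ν.re) :
    Summable (fun n : ℕ =>
      (-1 : ℂ)^n * (((Polynomial.aeval z) (Polynomial.hermite n) : ℝ) : ℂ)^2 /
        ((n.factorial : ℂ) * ((n : ℂ) + ν))) ∧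
    (∫ t in Ioi (0:ℝ), Complex.exp (-(z:ℂ) * t - (t:ℂ)^2 / 2) * (t:ℂ) ^ (ν - 1)) ^ 2 =
    Complex.Gamma ν *
      ∑' n : ℕ, (-1 : ℂ)^n *
        (((Polynomial.aeval z) (Polynomial.hermite n) : ℝ) : ℂ)^2 /
        ((n.factorial : ℂ) * ((n : ℂ) + ν)) := by
  have h := series_int z ν hν
  exact ⟨h.summable, by rw [h.tsum_eq]; exact main_aux z hz ν hν⟩
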